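/- arXiv:1006.3470 — 2 statements merged into one kernel-verified Lean document; each statement's English description precedes it below -/
import Mathlib

section
/- There exists a function C : [0,∞) → [0,∞) such that for every T̄ > 0 and every u in the backward framework with finite energy E(T̄), one has sup_{(t,r) ∈ D(T̄)} |u(t,r)| ≤ C(E(T̄)); i.e., the L∞ norm of u on D(T̄) is bounded by a constant depending only on the energy E(T̄). -/
open Real MeasureTheory Set Filter Topology

/-- Time derivative `u_t`. -/
noncomputable def ut (u : ℝ → ℝ → ℝ) (t r : ℝ) : ℝ := deriv (fun s => u s r) t

/-- Radial derivative `u_r`. -/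
noncomputable def ur (u : ℝ → ℝ → ℝ) (t r : ℝ) : ℝ := deriv (fun s => u t s) r

/-- Second time derivative `u_tt`. -/
noncomputable def utt (u : ℝ → ℝ → ℝ) (t r : ℝ) : ℝ := deriv (fun s => ut u s r) t

/-- Second radial derivative `u_rr`. -/
noncomputable def urr (u : ℝ → ℝ → ℝ) (t r : ℝ) : ℝ := deriv (fun s => ur u t s) r

/-- Null derivative `u₊ = u_t + u_r`. -/
noncomputable def uplus (u : ℝ → ℝ → ℝ) (t r : ℝ) : ℝ := ut u t r + ur u t r

/-- Null derivative `u₋ = u_t - u_r`. -/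
noncomputable def uminus (u : ℝ → ℝ → ℝ) (t r : ℝ) : ℝ := ut u t r - ur u t r

/-- The Adkins–Nappi equivariant wave equation at the point `(t, r)`. -/
def ANeq (u : ℝ → ℝ → ℝ) (t r : ℝ) : Prop :=
  utt u t r - urr u t r - (2 / r) * ur u t r + Real.sin (2 * u t r) / r ^ 2 +
      (u t r - Real.sin (u t r) * Real.cos (u t r)) * (1 - Real.cos (2 * u t r)) / r ^ 4 = 0

/-- The energy density `e(t,r)`. -/
noncomputable def eDens (u : ℝ → ℝ → ℝ) (t r : ℝ) : ℝ :=
  (1 / 2) * (ut u t r ^ 2 + ur u t r ^ 2) + Real.sin (u t r) ^ 2 / r ^ 2 +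
    (u t r - Real.sin (u t r) * Real.cos (u t r)) ^ 2 / (2 * r ^ 4)

/-- The backward domain `D(T̄)`. -/
def Dom (T : ℝ) : Set (ℝ × ℝ) :=
  {p : ℝ × ℝ | 0 < p.1 ∧ p.1 ≤ 2 * T ∧ 0 ≤ p.2 ∧ p.2 ≤ min (2 * T - p.1) p.1}

/-- The local energy `E(t) = ∫_0^t e(t,r) r² dr`. -/
noncomputable def locE (u : ℝ → ℝ → ℝ) (t : ℝ) : ℝ := ∫ r in (0 : ℝ)..t, eDens u t r * r ^ 2

/-- The flux `F(t₀, t₁)` through the light cone `t = r`. -/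
noncomputable def flux (u : ℝ → ℝ → ℝ) (t₀ t₁ : ℝ) : ℝ :=
  ∫ r in t₀..t₁,
    ((1 / 2) * uplus u r r ^ 2 + Real.sin (u r r) ^ 2 / r ^ 2 +
      (u r r - Real.sin (u r r) * Real.cos (u r r)) ^ 2 / (2 * r ^ 4)) * r ^ 2

/-- The backward framework: `u` is smooth on a neighborhood of `D(T̄)`, solves the
Adkins–Nappi equation on `D(T̄)` (for `r > 0`), and has finite energy `E(T̄)`. -/
def BackwardFramework (u : ℝ → ℝ → ℝ) (T : ℝ) : Prop :=
  0 < T ∧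
  (∃ V : Set (ℝ × ℝ), IsOpen V ∧ Dom T ⊆ V ∧
    ContDiffOn ℝ (⊤ : ℕ∞) (fun p : ℝ × ℝ => u p.1 p.2) V) ∧
  (∀ p ∈ Dom T, 0 < p.2 → ANeq u p.1 p.2) ∧
  IntegrableOn (fun r => eDens u T r * r ^ 2) (Set.Ioc 0 T)

section Calculus

variable {F : ℝ × ℝ → ℝ} {u : ℝ → ℝ → ℝ} {V : Set (ℝ × ℝ)} {t r : ℝ}

lemma DifferentiableAt.hasDerivAt_curve (h : DifferentiableAt ℝ F (t, r)) {a b : ℝ → ℝ}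
    {a' b' x : ℝ} (ha : HasDerivAt a a' x) (hb : HasDerivAt b b' x) (hax : a x = t)
    (hbx : b x = r) :
    HasDerivAt (fun s => F (a s, b s))
      (a' * fderiv ℝ F (t, r) (1, 0) + b' * fderiv ℝ F (t, r) (0, 1)) x := by
  subst hax hbx
  have h1 := h.hasFDerivAt.comp_hasDerivAt x (ha.prodMk hb)
  have h2 : ((a', b') : ℝ × ℝ) = a' • ((1, 0) : ℝ × ℝ) + b' • ((0, 1) : ℝ × ℝ) := by simp
  rw [h2, map_add, map_smul, map_smul, smul_eq_mul, smul_eq_mul] at h1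
  exact h1

lemma DifferentiableAt.hasDerivAt_partial_fst (h : DifferentiableAt ℝ F (t, r)) :
    HasDerivAt (fun s => F (s, r)) (fderiv ℝ F (t, r) (1, 0)) t := by
  simpa using h.hasDerivAt_curve (hasDerivAt_id t) (hasDerivAt_const t r) rfl rfl

lemma DifferentiableAt.hasDerivAt_partial_snd (h : DifferentiableAt ℝ F (t, r)) :
    HasDerivAt (fun s => F (t, s)) (fderiv ℝ F (t, r) (0, 1)) r := by
  simpa using h.hasDerivAt_curve (hasDerivAt_const r t) (hasDerivAt_id r) rfl rfl

lemma ContDiffOn.differentiableAt_of_isOpen_mem (hV : IsOpen V)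
    (hF : ContDiffOn ℝ (⊤ : ℕ∞) F V) {p : ℝ × ℝ} (hp : p ∈ V) : DifferentiableAt ℝ F p :=
  (hF.contDiffAt (hV.mem_nhds hp)).differentiableAt (by simp)

lemma ContDiffOn.fderiv_apply_of_isOpen (hV : IsOpen V) (hF : ContDiffOn ℝ (⊤ : ℕ∞) F V)
    (v : ℝ × ℝ) : ContDiffOn ℝ (⊤ : ℕ∞) (fun p => fderiv ℝ F p v) V :=
  (hF.fderiv_of_isOpen hV (by simp)).clm_apply contDiffOn_const

lemma contDiffOn_ut (hV : IsOpen V) (hu : ContDiffOn ℝ (⊤ : ℕ∞) (fun p : ℝ × ℝ => u p.1 p.2) V) :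
    ContDiffOn ℝ (⊤ : ℕ∞) (fun p : ℝ × ℝ => ut u p.1 p.2) V :=
  (hu.fderiv_apply_of_isOpen hV (1, 0)).congr fun _ hp =>
    (hu.differentiableAt_of_isOpen_mem hV hp).hasDerivAt_partial_fst.deriv

lemma contDiffOn_ur (hV : IsOpen V) (hu : ContDiffOn ℝ (⊤ : ℕ∞) (fun p : ℝ × ℝ => u p.1 p.2) V) :
    ContDiffOn ℝ (⊤ : ℕ∞) (fun p : ℝ × ℝ => ur u p.1 p.2) V :=
  (hu.fderiv_apply_of_isOpen hV (0, 1)).congr fun _ hp =>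
    (hu.differentiableAt_of_isOpen_mem hV hp).hasDerivAt_partial_snd.deriv

lemma contDiffOn_utt (hV : IsOpen V)
    (hu : ContDiffOn ℝ (⊤ : ℕ∞) (fun p : ℝ × ℝ => u p.1 p.2) V) :
    ContDiffOn ℝ (⊤ : ℕ∞) (fun p : ℝ × ℝ => utt u p.1 p.2) V :=
  contDiffOn_ut hV (contDiffOn_ut hV hu)

lemma contDiffOn_urr (hV : IsOpen V)
    (hu : ContDiffOn ℝ (⊤ : ℕ∞) (fun p : ℝ × ℝ => u p.1 p.2) V) :
    ContDiffOn ℝ (⊤ : ℕ∞) (fun p : ℝ × ℝ => urr u p.1 p.2) V :=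
  contDiffOn_ur hV (contDiffOn_ur hV hu)

lemma hasDerivAt_fst_of_contDiffOn (hV : IsOpen V)
    (hu : ContDiffOn ℝ (⊤ : ℕ∞) (fun p : ℝ × ℝ => u p.1 p.2) V) (hp : (t, r) ∈ V) :
    HasDerivAt (fun s => u s r) (ut u t r) t :=
  (hu.differentiableAt_of_isOpen_mem hV hp).hasDerivAt_partial_fst.differentiableAt.hasDerivAt

lemma hasDerivAt_snd_of_contDiffOn (hV : IsOpen V)
    (hu : ContDiffOn ℝ (⊤ : ℕ∞) (fun p : ℝ × ℝ => u p.1 p.2) V) (hp : (t, r) ∈ V) :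
    HasDerivAt (fun s => u t s) (ur u t r) r :=
  (hu.differentiableAt_of_isOpen_mem hV hp).hasDerivAt_partial_snd.differentiableAt.hasDerivAt

lemma ut_ur_eq_ur_ut (hV : IsOpen V)
    (hu : ContDiffOn ℝ (⊤ : ℕ∞) (fun p : ℝ × ℝ => u p.1 p.2) V) (hp : (t, r) ∈ V) :
    ut (ur u) t r = ur (ut u) t r := by
  set U : ℝ × ℝ → ℝ := fun p => u p.1 p.2
  have hnhds : V ∈ 𝓝 (t, r) := hV.mem_nhds hp
  have hd : DifferentiableAt ℝ (fderiv ℝ U) (t, r) :=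
    ((hu.fderiv_of_isOpen hV (m := (⊤ : ℕ∞)) (by simp)).contDiffAt hnhds).differentiableAt
      (by simp)
  have hsymm : IsSymmSndFDerivAt ℝ U (t, r) :=
    (hu.contDiffAt hnhds).isSymmSndFDerivAt (by
      simpa using (mod_cast le_top : ((2 : ℕ∞) : WithTop ℕ∞) ≤ ((⊤ : ℕ∞) : WithTop ℕ∞)))
  have h1 : (fun p : ℝ × ℝ => ur u p.1 p.2) =ᶠ[𝓝 (t, r)] fun p => fderiv ℝ U p (0, 1) :=
    Filter.eventually_of_mem hnhds fun p hp =>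
      (hu.differentiableAt_of_isOpen_mem hV hp).hasDerivAt_partial_snd.deriv
  have h2 : (fun p : ℝ × ℝ => ut u p.1 p.2) =ᶠ[𝓝 (t, r)] fun p => fderiv ℝ U p (1, 0) :=
    Filter.eventually_of_mem hnhds fun p hp =>
      (hu.differentiableAt_of_isOpen_mem hV hp).hasDerivAt_partial_fst.deriv
  have e1 : ut (ur u) t r = fderiv ℝ (fun p : ℝ × ℝ => ur u p.1 p.2) (t, r) (1, 0) :=
    ((contDiffOn_ur hV hu).differentiableAt_of_isOpen_mem hV hp).hasDerivAt_partial_fst.deriv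
  have e2 : ur (ut u) t r = fderiv ℝ (fun p : ℝ × ℝ => ut u p.1 p.2) (t, r) (0, 1) :=
    ((contDiffOn_ut hV hu).differentiableAt_of_isOpen_mem hV hp).hasDerivAt_partial_snd.deriv
  have hc (v : ℝ × ℝ) : fderiv ℝ (fun p => fderiv ℝ U p v) (t, r) =
      (fderiv ℝ (fderiv ℝ U) (t, r)).flip v := by
    rw [fderiv_clm_apply hd (differentiableAt_const v)]
    simp
  rw [e1, e2, h1.fderiv_eq, h2.fderiv_eq, hc, hc]
  exact hsymm (1, 0) (0, 1)

end Calculus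

/-- The conservation law `∂ₜ(r² e) = ∂ᵣ(r² u_t u_r)`. -/
lemma ANeq.exists_energy_derivs {u : ℝ → ℝ → ℝ} {V : Set (ℝ × ℝ)} {t r : ℝ} (hV : IsOpen V)
    (hu : ContDiffOn ℝ (⊤ : ℕ∞) (fun p : ℝ × ℝ => u p.1 p.2) V) (hp : (t, r) ∈ V) (hr : 0 < r)
    (h : ANeq u t r) :
    ∃ D, HasDerivAt (fun s => eDens u s r * r ^ 2) D t ∧
      HasDerivAt (fun x => x ^ 2 * (ut u t x * ur u t x)) D r := by
  have hut := contDiffOn_ut hV hu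
  have hur := contDiffOn_ur hV hu
  have d0 : HasDerivAt (fun s => u s r) (ut u t r) t := hasDerivAt_fst_of_contDiffOn hV hu hp
  have d1 : HasDerivAt (fun s => ut u s r) (utt u t r) t := hasDerivAt_fst_of_contDiffOn hV hut hp
  have d2 : HasDerivAt (fun s => ur u s r) (ur (ut u) t r) t := by
    rw [← ut_ur_eq_ur_ut hV hu hp]; exact hasDerivAt_fst_of_contDiffOn hV hur hp
  have d3 : HasDerivAt (fun x => ut u t x) (ur (ut u) t r) r :=
    hasDerivAt_snd_of_contDiffOn hV hut hp
  have d4 : HasDerivAt (fun x => ur u t x) (urr u t r) r := hasDerivAt_snd_of_contDiffOn hV hur hp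
  refine ⟨_, ?_, ((hasDerivAt_id r).pow 2).mul (d3.mul d4)⟩
  have e := ((((d1.pow 2).add (d2.pow 2)).const_mul (1 / 2)).add
    ((d0.sin.pow 2).div_const (r ^ 2))).add
    (((d0.sub (d0.sin.mul d0.cos)).pow 2).div_const (2 * r ^ 4)) |>.mul_const (r ^ 2)
  refine e.congr_deriv ?_
  unfold ANeq at h
  rw [Real.sin_two_mul, Real.cos_two_mul] at h
  have hs := Real.sin_sq_add_cos_sq (u t r)
  have h3 : utt u t r = urr u t r + (2 / r) * ur u t r -
      2 * Real.sin (u t r) * Real.cos (u t r) / r ^ 2 -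
      (u t r - Real.sin (u t r) * Real.cos (u t r)) *
        (2 * Real.sin (u t r) ^ 2) / r ^ 4 := by
    have : 1 - (2 * Real.cos (u t r) ^ 2 - 1) = 2 * Real.sin (u t r) ^ 2 := by linarith
    rw [this] at h
    linarith
  have hc : Real.cos (u t r) * Real.cos (u t r) = 1 - Real.sin (u t r) ^ 2 := by linarith
  simp only [id, h3]
  have h5 : ut u t r - (Real.cos (u t r) * ut u t r * Real.cos (u t r) +
      Real.sin (u t r) * (-Real.sin (u t r) * ut u t r)) =
      2 * Real.sin (u t r) ^ 2 * ut u t r := by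
    linear_combination (-ut u t r) * hc
  simp only [Pi.sub_apply, Pi.mul_apply, Pi.pow_apply, id, h5]
  field_simp
  ring

lemma intervalIntegral_swap_of_continuousOn {f : ℝ → ℝ → ℝ} {a b c d : ℝ} (hab : a ≤ b)
    (hcd : c ≤ d) (hf : ContinuousOn (fun p : ℝ × ℝ => f p.1 p.2) (Icc a b ×ˢ Icc c d)) :
    ∫ x in a..b, ∫ y in c..d, f x y = ∫ y in c..d, ∫ x in a..b, f x y := by
  simp only [intervalIntegral.integral_of_le hab, intervalIntegral.integral_of_le hcd]
  refine integral_integral_swap ?_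
  rw [Measure.prod_restrict]
  exact (hf.integrableOn_compact (isCompact_Icc.prod isCompact_Icc)).mono_set
    (prod_mono Ioc_subset_Icc_self Ioc_subset_Icc_self)

/-- Divergence theorem on a trapezoid with one characteristic side, for `∂ₜQ = ∂ᵣP`. -/
lemma integral_trapezoid_of_conservation_law {P Q : ℝ × ℝ → ℝ} {W : Set (ℝ × ℝ)} (hW : IsOpen W)
    (hP : ContDiffOn ℝ (⊤ : ℕ∞) P W) (hQ : ContDiffOn ℝ (⊤ : ℕ∞) Q W) {t₀ σ ε ρ S : ℝ}
    (hS : 0 ≤ S) (hε : ε ≤ ρ)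
    (hmem : ∀ s ∈ Icc 0 S, ∀ r ∈ Icc ε (ρ + s), (t₀ + σ * s, r) ∈ W)
    (hlaw : ∀ s ∈ Icc 0 S, ∀ r ∈ Icc ε (ρ + s), ∃ D,
      HasDerivAt (fun x => Q (x, r)) D (t₀ + σ * s) ∧
      HasDerivAt (fun x => P (t₀ + σ * s, x)) D r) :
    (∫ r in ε..ρ + S, Q (t₀ + σ * S, r)) - ∫ r in ε..ρ, Q (t₀, r) =
      ∫ s in (0 : ℝ)..S, (σ * P (t₀ + σ * s, ρ + s) + Q (t₀ + σ * s, ρ + s) -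
        σ * P (t₀ + σ * s, ε)) := by
  set m : ℝ → ℝ := fun s => ρ + s - ε with hm
  set φ : ℝ × ℝ → ℝ × ℝ := fun z => (t₀ + σ * z.1, ε + m z.1 * z.2) with hφ
  have hφr : ∀ s ∈ Icc 0 S, ∀ y ∈ Icc (0 : ℝ) 1, ε + m s * y ∈ Icc ε (ρ + s) := by
    intro s hs y hy
    have h0 : 0 ≤ m s := by simp only [hm]; linarith [hs.1]
    have h1 : m s * y ≤ m s := mul_le_of_le_one_right h0 hy.2
    exact ⟨by nlinarith [hy.1], by simp only [hm] at h1 ⊢; linarith⟩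
  have hφW : ∀ s ∈ Icc 0 S, ∀ y ∈ Icc (0 : ℝ) 1, φ (s, y) ∈ W := fun s hs y hy =>
    hmem s hs _ (hφr s hs y hy)
  set D : ℝ → ℝ → ℝ := fun s y => (σ * fderiv ℝ Q (φ (s, y)) (1, 0) +
    y * fderiv ℝ Q (φ (s, y)) (0, 1)) * m s + Q (φ (s, y)) with hD
  have hmaps : MapsTo φ (Icc 0 S ×ˢ Icc (0 : ℝ) 1) W := fun z hz => hφW z.1 hz.1 z.2 hz.2
  have hφc : Continuous φ := by simp only [hφ, hm]; fun_prop
  have hQ1 (v : ℝ × ℝ) := ((hQ.fderiv_apply_of_isOpen hW v).continuousOn.comp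
    hφc.continuousOn hmaps)
  have hDc : ContinuousOn (fun z : ℝ × ℝ => D z.1 z.2) (Icc 0 S ×ˢ Icc (0 : ℝ) 1) := by
    have h1 := hQ1 (1, 0)
    have h2 := hQ1 (0, 1)
    have h3 := hQ.continuousOn.comp hφc.continuousOn hmaps
    have h4 : Continuous m := by simp only [hm]; fun_prop
    exact (((continuousOn_const.mul h1).add (continuousOn_snd.mul h2)).mul
      (h4.comp continuous_fst).continuousOn).add h3
  have hDs : ∀ s ∈ Icc 0 S, ContinuousOn (fun y => D s y) (Icc (0 : ℝ) 1) := fun s hs =>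
    hDc.comp (f := fun y => (s, y)) (by fun_prop) fun y hy => ⟨hs, hy⟩
  have hDy : ∀ y ∈ Icc (0 : ℝ) 1, ContinuousOn (fun s => D s y) (Icc 0 S) := fun y hy =>
    hDc.comp (f := fun s => (s, y)) (by fun_prop) fun s hs => ⟨hs, hy⟩
  have hA : ∀ s ∈ Icc 0 S, ∀ y ∈ Icc (0 : ℝ) 1,
      HasDerivAt (fun x => Q (φ (x, y)) * m x) (D s y) s := by
    intro s hs y hy
    have hms : HasDerivAt m 1 s := ((hasDerivAt_id s).const_add ρ).sub_const ε
    have h1 : HasDerivAt (fun x => t₀ + σ * x) σ s := by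
      simpa using ((hasDerivAt_id s).const_mul σ).const_add t₀
    have h2 : HasDerivAt (fun x => ε + m x * y) y s := by
      simpa using (hms.mul_const y).const_add ε
    have h3 := (hQ.differentiableAt_of_isOpen_mem hW (hφW s hs y hy)).hasDerivAt_curve h1 h2
      rfl rfl
    exact (h3.mul hms).congr_deriv (by simp only [hD, hφ]; ring)
  have hB : ∀ s ∈ Icc 0 S, ∀ y ∈ Icc (0 : ℝ) 1,
      HasDerivAt (fun x => σ * P (φ (s, x)) + x * Q (φ (s, x))) (D s y) y := by
    intro s hs y hy
    have h1 : HasDerivAt (fun _ : ℝ => t₀ + σ * s) 0 y := hasDerivAt_const _ _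
    have h2 : HasDerivAt (fun x => ε + m s * x) (m s) y := by
      simpa using ((hasDerivAt_id y).const_mul (m s)).const_add ε
    have hPd := hP.differentiableAt_of_isOpen_mem hW (hφW s hs y hy)
    have hQd := hQ.differentiableAt_of_isOpen_mem hW (hφW s hs y hy)
    obtain ⟨d, hd1, hd2⟩ := hlaw s hs _ (hφr s hs y hy)
    have e : fderiv ℝ P (φ (s, y)) (0, 1) = fderiv ℝ Q (φ (s, y)) (1, 0) :=
      (hPd.hasDerivAt_partial_snd.unique hd2).trans (hQd.hasDerivAt_partial_fst.unique hd1).symm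
    refine (((hPd.hasDerivAt_curve h1 h2 rfl rfl).const_mul σ).add
      ((hasDerivAt_id' y).mul (hQd.hasDerivAt_curve h1 h2 rfl rfl))).congr_deriv ?_
    linear_combination σ * m s * e
  have hswap := intervalIntegral_swap_of_continuousOn hS zero_le_one hDc
  have hL : ∫ s in (0 : ℝ)..S, ∫ y in (0 : ℝ)..1, D s y =
      ∫ s in (0 : ℝ)..S, (σ * P (t₀ + σ * s, ρ + s) + Q (t₀ + σ * s, ρ + s) -
        σ * P (t₀ + σ * s, ε)) := by
    refine intervalIntegral.integral_congr fun s hs => ?_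
    rw [uIcc_of_le hS] at hs
    rw [intervalIntegral.integral_eq_sub_of_hasDerivAt
      (f := fun x => σ * P (φ (s, x)) + x * Q (φ (s, x)))
      (fun y hy => hB s hs y (by rwa [uIcc_of_le zero_le_one] at hy))
      ((hDs s hs).intervalIntegrable_of_Icc zero_le_one)]
    simp [hφ, hm]
  have hR : ∫ y in (0 : ℝ)..1, ∫ s in (0 : ℝ)..S, D s y =
      ∫ y in (0 : ℝ)..1, (Q (φ (S, y)) * m S - Q (φ (0, y)) * m 0) := by
    refine intervalIntegral.integral_congr fun y hy => ?_
    rw [uIcc_of_le zero_le_one] at hy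
    exact intervalIntegral.integral_eq_sub_of_hasDerivAt
      (f := fun x => Q (φ (x, y)) * m x)
      (fun s hs => hA s (by rwa [uIcc_of_le hS] at hs) y hy)
      ((hDy y hy).intervalIntegrable_of_Icc hS)
  have hint : ∀ s ∈ Icc 0 S, IntervalIntegrable (fun y => Q (φ (s, y)) * m s) volume 0 1 :=
    fun s hs => by
      refine (ContinuousOn.mul ?_ continuousOn_const).intervalIntegrable_of_Icc zero_le_one
      exact (hQ.continuousOn.comp hφc.continuousOn hmaps).comp (f := fun y => (s, y))
        (by fun_prop) fun y hy => ⟨hs, hy⟩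
  have hslice (s : ℝ) : ∫ y in (0 : ℝ)..1, Q (φ (s, y)) * m s =
      ∫ r in ε..ρ + s, Q (t₀ + σ * s, r) := by
    rw [intervalIntegral.integral_mul_const, mul_comm]
    have := intervalIntegral.mul_integral_comp_add_mul (a := 0) (b := 1)
      (f := fun r => Q (t₀ + σ * s, r)) (c := m s) ε
    simp only [hφ]
    rw [this]
    simp [hm]
  rw [← hL, hswap, hR, intervalIntegral.integral_sub (hint S ⟨hS, le_rfl⟩) (hint 0 ⟨le_rfl, hS⟩),
    hslice, hslice]
  simp

lemma eDens_nonneg (u : ℝ → ℝ → ℝ) (t r : ℝ) : 0 ≤ eDens u t r := by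
  unfold eDens; positivity

lemma Real.sub_sin_mul_cos_ne_zero {x : ℝ} (hx : x ≠ 0) : x - Real.sin x * Real.cos x ≠ 0 := by
  intro h
  have h2 : Real.sin (2 * x) = 2 * x := by rw [Real.sin_two_mul]; linarith
  rcases lt_or_gt_of_ne hx with hx | hx
  · have := Real.sin_lt (x := -(2 * x)) (by linarith)
    rw [Real.sin_neg] at this; linarith
  · have := Real.sin_lt (x := 2 * x) (by linarith)
    linarith

lemma eq_zero_of_eDens_integrable {u : ℝ → ℝ → ℝ} {T : ℝ} (hT : 0 < T)
    (hc : ContinuousAt (fun r => u T r) 0)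
    (hint : IntegrableOn (fun r => eDens u T r * r ^ 2) (Ioc 0 T)) : u T 0 = 0 := by
  by_contra h0
  set g : ℝ → ℝ := fun r => (u T r - Real.sin (u T r) * Real.cos (u T r)) ^ 2 with hg
  have hgc : ContinuousAt g 0 :=
    (hc.sub ((Real.continuous_sin.continuousAt.comp hc).mul
      (Real.continuous_cos.continuousAt.comp hc))).pow 2
  have hg0 : 0 < g 0 := by
    have := Real.sub_sin_mul_cos_ne_zero h0
    positivity
  obtain ⟨δ, hδ, hball⟩ := Metric.eventually_nhds_iff.1
    (hgc.eventually (lt_mem_nhds (half_lt_self hg0)))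
  set η := min (min (δ / 2) T) 1 with hη
  have hη0 : 0 < η := by positivity
  have hηδ : η < δ := ((min_le_left _ _).trans (min_le_left _ _)).trans_lt (half_lt_self hδ)
  have hηT : η ≤ T := (min_le_left _ _).trans (min_le_right _ _)
  have hη1 : η ≤ 1 := min_le_right _ _
  have hbound : ∀ r ∈ Ioc 0 η, ‖r⁻¹‖ ≤ (4 / g 0) * (eDens u T r * r ^ 2) := by
    intro r hr
    have hr0 : 0 < r := hr.1
    have hgr : g 0 / 2 < g r := hball (by
      rw [Real.dist_eq, sub_zero, abs_of_pos hr0]; exact hr.2.trans_lt hηδ)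
    have h1 : g r / (2 * r ^ 2) ≤ eDens u T r * r ^ 2 := by
      have : g r / (2 * r ^ 2) = g r / (2 * r ^ 4) * r ^ 2 := by field_simp
      rw [this]
      refine mul_le_mul_of_nonneg_right ?_ (by positivity)
      unfold eDens
      simp only [hg]
      have : 0 ≤ (1 / 2) * (ut u T r ^ 2 + ur u T r ^ 2) + Real.sin (u T r) ^ 2 / r ^ 2 := by
        positivity
      linarith
    rw [Real.norm_of_nonneg (by positivity)]
    refine le_trans ?_ (mul_le_mul_of_nonneg_left h1 (by positivity))
    rw [div_mul_div_comm, inv_eq_one_div, div_le_div_iff₀ hr0 (by positivity)]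
    have : r ≤ 1 := hr.2.trans hη1
    nlinarith [mul_pos hg0 hr0, mul_pos hr0 (sub_pos.2 hgr)]
  have hinv : IntegrableOn (fun r : ℝ => r⁻¹) (Ioc 0 η) := by
    refine Integrable.mono' ((hint.mono_set (Ioc_subset_Ioc_right hηT)).const_mul (4 / g 0))
      (measurable_inv.aestronglyMeasurable) ?_
    filter_upwards [ae_restrict_mem measurableSet_Ioc] with r hr using hbound r hr
  have := (intervalIntegrable_iff_integrableOn_Ioc_of_le hη0.le).2 hinv
  rcases intervalIntegrable_inv_iff.1 this with h | h
  · exact hη0.ne h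
  · exact h left_mem_uIcc

lemma mem_Dom_axis {T t : ℝ} (h0 : 0 < t) (h1 : t ≤ 2 * T) : (t, (0 : ℝ)) ∈ Dom T :=
  ⟨h0, h1, le_rfl, le_min (by simpa using h1) h0.le⟩

/-- On the axis the equation forces `u` to take values in `πℤ`. -/
lemma sin_axis_eq_zero {u : ℝ → ℝ → ℝ} {T t : ℝ} {V : Set (ℝ × ℝ)} (hV : IsOpen V)
    (hDV : Dom T ⊆ V) (hu : ContDiffOn ℝ (⊤ : ℕ∞) (fun p : ℝ × ℝ => u p.1 p.2) V)
    (heq : ∀ p ∈ Dom T, 0 < p.2 → ANeq u p.1 p.2) (h0 : 0 < t) (h1 : t < 2 * T) :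
    Real.sin (u t 0) = 0 := by
  have hp : (t, (0 : ℝ)) ∈ V := hDV (mem_Dom_axis h0 h1.le)
  have hcont {F : ℝ × ℝ → ℝ} (hF : ContDiffOn ℝ (⊤ : ℕ∞) F V) :
      ContinuousAt (fun r => F (t, r)) 0 :=
    (hF.differentiableAt_of_isOpen_mem hV hp).hasDerivAt_partial_snd.continuousAt
  have c0 : ContinuousAt (fun r => u t r) 0 := hcont hu
  have c1 : ContinuousAt (fun r => ur u t r) 0 := hcont (contDiffOn_ur hV hu)
  have c2 : ContinuousAt (fun r => utt u t r) 0 := hcont (contDiffOn_utt hV hu)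
  have c3 : ContinuousAt (fun r => urr u t r) 0 := hcont (contDiffOn_urr hV hu)
  have cs := Real.continuous_sin.continuousAt.comp c0
  have cc := Real.continuous_cos.continuousAt.comp c0
  set H : ℝ → ℝ := fun r => r ^ 4 * utt u t r - r ^ 4 * urr u t r - 2 * r ^ 3 * ur u t r +
    r ^ 2 * (2 * Real.sin (u t r) * Real.cos (u t r)) +
    (u t r - Real.sin (u t r) * Real.cos (u t r)) * (2 * Real.sin (u t r) ^ 2) with hH
  have hHc : ContinuousAt H 0 := by
    have ci : ContinuousAt (fun r : ℝ => r) 0 := continuousAt_id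
    exact (((((ci.pow 4).mul c2).sub ((ci.pow 4).mul c3)).sub
      ((continuousAt_const.mul (ci.pow 3)).mul c1)).add
      ((ci.pow 2).mul ((continuousAt_const.mul cs).mul cc))).add
      ((c0.sub (cs.mul cc)).mul (continuousAt_const.mul (cs.pow 2)))
  have hev : ∀ᶠ r in 𝓝[>] (0 : ℝ), H r = 0 := by
    have hpos : 0 < min (2 * T - t) t := lt_min (by linarith) h0
    filter_upwards [Ioo_mem_nhdsGT hpos] with r hr
    have hr0 : 0 < r := hr.1
    have h := heq (t, r) ⟨h0, h1.le, hr.1.le, hr.2.le⟩ hr.1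
    simp only [ANeq] at h
    rw [Real.sin_two_mul] at h
    have h2 : 1 - Real.cos (2 * u t r) = 2 * Real.sin (u t r) ^ 2 := by
      rw [Real.cos_two_mul]; linarith [Real.sin_sq_add_cos_sq (u t r)]
    rw [h2] at h
    have h3 : H r = r ^ 4 * (utt u t r - urr u t r - 2 / r * ur u t r +
        2 * Real.sin (u t r) * Real.cos (u t r) / r ^ 2 +
        (u t r - Real.sin (u t r) * Real.cos (u t r)) * (2 * Real.sin (u t r) ^ 2) / r ^ 4) := by
      simp only [hH]; field_simp
    rw [h3, h, mul_zero]
  have hH0 : H 0 = 0 :=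
    tendsto_nhds_unique ((hHc.tendsto.mono_left nhdsWithin_le_nhds).congr' hev) tendsto_const_nhds
  simp only [hH] at hH0
  have h4 : (u t 0 - Real.sin (u t 0) * Real.cos (u t 0)) * (2 * Real.sin (u t 0) ^ 2) = 0 := by
    simpa using hH0
  rcases mul_eq_zero.1 h4 with h | h
  · have : u t 0 = 0 := by_contra fun hne => Real.sub_sin_mul_cos_ne_zero hne h
    rw [this, Real.sin_zero]
  · simpa using h

lemma eq_zero_of_sin_comp_eq_zero {h : ℝ → ℝ} {s : Set ℝ} (hs : s.OrdConnected)
    (hc : ContinuousOn h s) (hsin : ∀ x ∈ s, Real.sin (h x) = 0) {a b : ℝ} (ha : a ∈ s)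
    (hb : b ∈ s) (h0 : h a = 0) : h b = 0 := by
  by_contra hne
  have hpos : 0 < |h b| := abs_pos.2 hne
  have hsub : uIcc a b ⊆ s := hs.uIcc_subset ha hb
  have hivt := intermediate_value_uIcc (hc.mono hsub).abs
  have hmem : min |h b| 1 ∈ uIcc |h a| |h b| := by
    rw [h0, abs_zero, uIcc_of_le hpos.le]
    exact ⟨by positivity, min_le_left _ _⟩
  obtain ⟨x, hx, hxe⟩ := hivt hmem
  simp only at hxe
  have h1 : 0 < |h x| := by rw [hxe]; positivity
  have h2 : |h x| < Real.pi := by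
    rw [hxe]; exact (min_le_right _ _).trans_lt (by linarith [Real.pi_gt_three])
  have h3 := Real.sin_pos_of_pos_of_lt_pi h1 h2
  have h4 := hsin x (hsub hx)
  rcases abs_choice (h x) with e | e <;> rw [e] at h3
  · linarith
  · rw [Real.sin_neg] at h3; linarith

lemma BackwardFramework.eq_zero_on_axis {u : ℝ → ℝ → ℝ} {T t : ℝ} (h : BackwardFramework u T)
    (h0 : 0 < t) (h1 : t ≤ 2 * T) : u t 0 = 0 := by
  obtain ⟨hT, ⟨V, hV, hDV, hu⟩, heq, hint⟩ := h
  have hmem {t : ℝ} (h0 : 0 < t) (h1 : t ≤ 2 * T) : (t, (0 : ℝ)) ∈ V := hDV (mem_Dom_axis h0 h1)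
  have hT0 : u T 0 = 0 := eq_zero_of_eDens_integrable hT
    (hasDerivAt_snd_of_contDiffOn hV hu (hmem hT (by linarith))).continuousAt hint
  have hc (s : ℝ) (hs : s ∈ Ioc 0 (2 * T)) : ContinuousAt (fun s => u s 0) s :=
    (hasDerivAt_fst_of_contDiffOn hV hu (hmem hs.1 hs.2)).continuousAt
  have hcon : ContinuousOn (fun s => u s 0) (Ioo 0 (2 * T)) := fun s hs =>
    (hc s ⟨hs.1, hs.2.le⟩).continuousWithinAt
  have hin : ∀ s ∈ Ioo 0 (2 * T), u s 0 = 0 := fun s hs =>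
    eq_zero_of_sin_comp_eq_zero ordConnected_Ioo hcon
      (fun x hx => sin_axis_eq_zero hV hDV hu heq hx.1 hx.2)
      ⟨hT, by linarith⟩ hs hT0
  rcases h1.lt_or_eq with h1 | rfl
  · exact hin t ⟨h0, h1⟩
  · have hev : ∀ᶠ s in 𝓝[<] (2 * T), u s 0 = 0 := by
      filter_upwards [Ioo_mem_nhdsLT h0] with s hs using hin s hs
    exact tendsto_nhds_unique
      (((hc _ ⟨h0, le_rfl⟩).tendsto.mono_left nhdsWithin_le_nhds).congr' hev)
      tendsto_const_nhds

lemma contDiffOn_eDens_mul_sq {u : ℝ → ℝ → ℝ} {V : Set (ℝ × ℝ)} (hV : IsOpen V)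
    (hu : ContDiffOn ℝ (⊤ : ℕ∞) (fun p : ℝ × ℝ => u p.1 p.2) V) :
    ContDiffOn ℝ (⊤ : ℕ∞) (fun p : ℝ × ℝ => eDens u p.1 p.2 * p.2 ^ 2)
      (V ∩ {p : ℝ × ℝ | 0 < p.2}) := by
  have h0 := hu.mono (inter_subset_left (t := {p : ℝ × ℝ | 0 < p.2}))
  have ht := (contDiffOn_ut hV hu).mono (inter_subset_left (t := {p : ℝ × ℝ | 0 < p.2}))
  have hr := (contDiffOn_ur hV hu).mono (inter_subset_left (t := {p : ℝ × ℝ | 0 < p.2}))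
  have h2 : ContDiffOn ℝ (⊤ : ℕ∞) (fun p : ℝ × ℝ => p.2) (V ∩ {p : ℝ × ℝ | 0 < p.2}) :=
    contDiffOn_snd
  have hne : ∀ p ∈ V ∩ {p : ℝ × ℝ | 0 < p.2}, p.2 ≠ 0 := fun p hp => ne_of_gt hp.2
  exact (((contDiffOn_const.mul ((ht.pow 2).add (hr.pow 2))).add
    ((h0.sin.pow 2).div (h2.pow 2) fun p hp => pow_ne_zero _ (hne p hp))).add
    (((h0.sub (h0.sin.mul h0.cos)).pow 2).div (contDiffOn_const.mul (h2.pow 4))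
      fun p hp => mul_ne_zero two_ne_zero (pow_ne_zero _ (hne p hp)))).mul (h2.pow 2)

lemma flux_density_nonneg {u : ℝ → ℝ → ℝ} {σ : ℝ} (hσ : σ ^ 2 = 1) (t r : ℝ) :
    0 ≤ σ * (r ^ 2 * (ut u t r * ur u t r)) + eDens u t r * r ^ 2 := by
  have : σ * (r ^ 2 * (ut u t r * ur u t r)) + eDens u t r * r ^ 2 =
      ((1 / 2) * (σ * ut u t r + ur u t r) ^ 2 + Real.sin (u t r) ^ 2 / r ^ 2 +
        (u t r - Real.sin (u t r) * Real.cos (u t r)) ^ 2 / (2 * r ^ 4)) * r ^ 2 := by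
    unfold eDens
    linear_combination (-(1 / 2) * ut u t r ^ 2 * r ^ 2) * hσ
  rw [this]
  positivity

/-- The potential `u²/2 - sin²u/2`, a primitive of `u - sin u cos u`, grows at most as the energy. -/
lemma potential_sub_le_integral_eDens {u : ℝ → ℝ → ℝ} {V : Set (ℝ × ℝ)} (hV : IsOpen V)
    (hu : ContDiffOn ℝ (⊤ : ℕ∞) (fun p : ℝ × ℝ => u p.1 p.2) V) {t a b : ℝ} (ha : 0 < a)
    (hab : a ≤ b) (hmem : ∀ r ∈ Icc a b, (t, r) ∈ V) :
    (u t b ^ 2 - Real.sin (u t b) ^ 2) / 2 - (u t a ^ 2 - Real.sin (u t a) ^ 2) / 2 ≤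
      ∫ r in a..b, eDens u t r * r ^ 2 := by
  have hslice {F : ℝ × ℝ → ℝ} {W : Set (ℝ × ℝ)} (hF : ContDiffOn ℝ (⊤ : ℕ∞) F W)
      (hW : ∀ r ∈ Icc a b, (t, r) ∈ W) : ContinuousOn (fun r => F (t, r)) (Icc a b) :=
    hF.continuousOn.comp (f := fun r => (t, r)) (by fun_prop) hW
  have c0 : ContinuousOn (fun r => u t r) (Icc a b) := hslice hu hmem
  have c1 : ContinuousOn (fun r => ur u t r) (Icc a b) := hslice (contDiffOn_ur hV hu) hmem
  have ce : ContinuousOn (fun r => eDens u t r * r ^ 2) (Icc a b) :=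
    hslice (contDiffOn_eDens_mul_sq hV hu) fun r hr => ⟨hmem r hr, ha.trans_le hr.1⟩
  have cd : ContinuousOn
      (fun r => (u t r - Real.sin (u t r) * Real.cos (u t r)) * ur u t r) (Icc a b) :=
    (c0.sub ((Real.continuous_sin.comp_continuousOn c0).mul
      (Real.continuous_cos.comp_continuousOn c0))).mul c1
  have hd : ∀ r ∈ uIcc a b, HasDerivAt (fun r => (u t r ^ 2 - Real.sin (u t r) ^ 2) / 2)
      ((u t r - Real.sin (u t r) * Real.cos (u t r)) * ur u t r) r := by
    intro r hr
    rw [uIcc_of_le hab] at hr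
    have h1 := hasDerivAt_snd_of_contDiffOn hV hu (hmem r hr)
    exact (((h1.pow 2).sub (h1.sin.pow 2)).div_const 2).congr_deriv (by simp; ring)
  rw [← intervalIntegral.integral_eq_sub_of_hasDerivAt hd (cd.intervalIntegrable_of_Icc hab)]
  refine intervalIntegral.integral_mono_on hab (cd.intervalIntegrable_of_Icc hab)
    (ce.intervalIntegrable_of_Icc hab) fun r hr => ?_
  have hr0 : 0 < r := ha.trans_le hr.1
  set g := u t r - Real.sin (u t r) * Real.cos (u t r) with hg
  have h1 : eDens u t r * r ^ 2 = (1 / 2) * ut u t r ^ 2 * r ^ 2 + Real.sin (u t r) ^ 2 +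
      (1 / 2) * (r * ur u t r - g / r) ^ 2 + g * ur u t r := by
    unfold eDens
    rw [← hg]
    field_simp
    ring
  rw [h1]
  have : 0 ≤ (1 / 2) * ut u t r ^ 2 * r ^ 2 + Real.sin (u t r) ^ 2 +
      (1 / 2) * (r * ur u t r - g / r) ^ 2 := by positivity
  linarith

/-- Local energy bound obtained by flowing along characteristics to the slice `t = T`. -/
lemma BackwardFramework.sq_le_of_characteristic {u : ℝ → ℝ → ℝ} {T t₀ r₀ σ S : ℝ}
    (h : BackwardFramework u T) (hσ : σ ^ 2 = 1) (hS : 0 ≤ S) (hT : t₀ + σ * S = T)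
    (hr₀ : 0 < r₀) (hrS : r₀ + S ≤ T)
    (hmem : ∀ s ∈ Icc 0 S, ∀ r ∈ Icc 0 (r₀ + s), (t₀ + σ * s, r) ∈ Dom T) :
    u t₀ r₀ ^ 2 ≤ 2 * locE u T + 1 := by
  have haxis : u t₀ 0 = 0 := by
    have := hmem 0 ⟨le_rfl, hS⟩ 0 ⟨le_rfl, by linarith⟩
    rw [mul_zero, add_zero] at this
    exact h.eq_zero_on_axis this.1 this.2.1
  obtain ⟨hTpos, ⟨V, hV, hDV, hu⟩, heq, hint⟩ := h
  set W : Set (ℝ × ℝ) := V ∩ {p : ℝ × ℝ | 0 < p.2} with hWdef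
  have hW : IsOpen W := hV.inter (isOpen_lt continuous_const continuous_snd)
  set Q : ℝ × ℝ → ℝ := fun p => eDens u p.1 p.2 * p.2 ^ 2 with hQdef
  set P : ℝ × ℝ → ℝ := fun p => p.2 ^ 2 * (ut u p.1 p.2 * ur u p.1 p.2) with hPdef
  have hQ : ContDiffOn ℝ (⊤ : ℕ∞) Q W := contDiffOn_eDens_mul_sq hV hu
  have hutur := (contDiffOn_ut hV hu).mul (contDiffOn_ur hV hu)
  have hP : ContDiffOn ℝ (⊤ : ℕ∞) P W :=
    (contDiffOn_snd.pow 2).mul (hutur.mono inter_subset_left)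
  obtain ⟨C, hC⟩ : ∃ C, ∀ z ∈ Icc 0 S ×ˢ Icc 0 r₀,
      ‖ut u (t₀ + σ * z.1) z.2 * ur u (t₀ + σ * z.1) z.2‖ ≤ C :=
    (isCompact_Icc.prod isCompact_Icc).exists_bound_of_continuousOn
      (hutur.continuousOn.comp (f := fun z : ℝ × ℝ => (t₀ + σ * z.1, z.2)) (by fun_prop)
        fun z hz => hDV (hmem z.1 hz.1 z.2 ⟨hz.2.1, hz.2.2.trans (by linarith [hz.1.1])⟩))
  have hkey : ∀ ε ∈ Ioo 0 r₀, (u t₀ r₀ ^ 2 - Real.sin (u t₀ r₀) ^ 2) / 2 ≤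
      (u t₀ ε ^ 2 - Real.sin (u t₀ ε) ^ 2) / 2 + locE u T + ε ^ 2 * C * S := by
    intro ε hε
    have hmW : ∀ s ∈ Icc 0 S, ∀ r ∈ Icc ε (r₀ + s), (t₀ + σ * s, r) ∈ W := fun s hs r hr =>
      ⟨hDV (hmem s hs r ⟨hε.1.le.trans hr.1, hr.2⟩), hε.1.trans_le hr.1⟩
    have htrap := integral_trapezoid_of_conservation_law hW hP hQ hS hε.2.le hmW
      fun s hs r hr => (heq _ (hmem s hs r ⟨hε.1.le.trans hr.1, hr.2⟩)
        (hε.1.trans_le hr.1)).exists_energy_derivs hV hu (hmW s hs r hr).1 (hε.1.trans_le hr.1)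
    have hcont {F : ℝ × ℝ → ℝ} (hF : ContDiffOn ℝ (⊤ : ℕ∞) F W) {b : ℝ → ℝ}
        (hb : Continuous b) (hbm : ∀ s ∈ Icc 0 S, b s ∈ Icc ε (r₀ + s)) :
        ContinuousOn (fun s => F (t₀ + σ * s, b s)) (Icc 0 S) :=
      hF.continuousOn.comp (f := fun s => (t₀ + σ * s, b s)) (by fun_prop)
        fun s hs => hmW s hs _ (hbm s hs)
    have houter : ∀ s ∈ Icc 0 S, r₀ + s ∈ Icc ε (r₀ + s) := fun s hs =>
      ⟨by linarith [hε.2, hs.1], le_rfl⟩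
    have hinner : ∀ s ∈ Icc 0 S, ε ∈ Icc ε (r₀ + s) := fun s hs =>
      ⟨le_rfl, by linarith [hε.2, hs.1]⟩
    have hlow : -(ε ^ 2 * C * S) ≤
        ∫ s in (0 : ℝ)..S, (σ * P (t₀ + σ * s, r₀ + s) + Q (t₀ + σ * s, r₀ + s) -
          σ * P (t₀ + σ * s, ε)) := by
      have hconst : ∫ _ in (0 : ℝ)..S, -(ε ^ 2 * C) = -(ε ^ 2 * C * S) := by
        rw [intervalIntegral.integral_const, smul_eq_mul]; ring
      rw [← hconst]
      refine intervalIntegral.integral_mono_on hS intervalIntegrable_const ?_ fun s hs => ?_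
      · exact (((continuousOn_const.mul (hcont hP (by fun_prop) houter)).add
          (hcont hQ (by fun_prop) houter)).sub
          (continuousOn_const.mul (hcont hP continuous_const hinner))).intervalIntegrable_of_Icc hS
      · have h1 := flux_density_nonneg (u := u) hσ (t₀ + σ * s) (r₀ + s)
        have h2 : σ * P (t₀ + σ * s, ε) ≤ ε ^ 2 * C := by
          have h3 := hC (s, ε) ⟨hs, hε.1.le, hε.2.le⟩
          have h4 : |σ| = 1 := by
            rcases (sq_eq_sq_iff_eq_or_eq_neg.1 (hσ.trans (one_pow 2).symm)) with e | e <;> simp [e]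
          calc σ * P (t₀ + σ * s, ε) ≤ |σ * P (t₀ + σ * s, ε)| := le_abs_self _
            _ = ε ^ 2 * |ut u (t₀ + σ * s) ε * ur u (t₀ + σ * s) ε| := by
              rw [abs_mul, h4, one_mul, hPdef]
              simp only
              rw [abs_mul, abs_of_nonneg (sq_nonneg ε)]
            _ ≤ ε ^ 2 * C := mul_le_mul_of_nonneg_left h3 (sq_nonneg ε)
        simp only [hPdef, hQdef] at h2 ⊢
        linarith
    have hpot := potential_sub_le_integral_eDens hV hu hε.1 hε.2.le (t := t₀) fun r hr => by
      have := (hmW 0 ⟨le_rfl, hS⟩ r (by simpa using hr)).1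
      simpa using this
    have htop : ∫ r in ε..r₀ + S, Q (t₀ + σ * S, r) ≤ locE u T := by
      rw [hT]
      refine intervalIntegral.integral_mono_interval hε.1.le (by linarith [hε.2]) hrS
        (Eventually.of_forall fun r => mul_nonneg (eDens_nonneg u T r) (sq_nonneg r)) ?_
      exact (intervalIntegrable_iff_integrableOn_Ioc_of_le hTpos.le).2 hint
    simp only [hQdef] at htrap htop hlow
    linarith
  have hu0 : Tendsto (fun ε => u t₀ ε) (𝓝[>] 0) (𝓝 0) := by
    have hm := hmem 0 ⟨le_rfl, hS⟩ 0 ⟨le_rfl, by linarith⟩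
    rw [mul_zero, add_zero] at hm
    have := (hasDerivAt_snd_of_contDiffOn hV hu (hDV hm)).continuousAt.tendsto
    rw [haxis] at this
    exact this.mono_left nhdsWithin_le_nhds
  have hid : Tendsto (fun ε : ℝ => ε) (𝓝[>] 0) (𝓝 0) := tendsto_id.mono_left nhdsWithin_le_nhds
  have hlim := ((((hu0.pow 2).sub
    (((Real.continuous_sin.tendsto 0).comp hu0).pow 2)).div_const 2).add_const (locE u T)).add
    (((hid.pow 2).mul_const C).mul_const S)
  have hle := ge_of_tendsto hlim (by
    filter_upwards [Ioo_mem_nhdsGT hr₀] with ε hε using hkey ε hε)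
  simp at hle
  linarith [Real.sin_sq_le_one (u t₀ r₀)]

/-- Uniform bound on `u` in terms of the energy alone: there is a function
`C : [0,∞) → [0,∞)` such that for any backward-framework solution,
`‖u‖_{L^∞(D(T̄))} ≤ C(E(T̄))`. -/
theorem linfty_bound_by_energy :
    ∃ C : ℝ → ℝ, (∀ x : ℝ, 0 ≤ x → 0 ≤ C x) ∧
      ∀ (Tbar : ℝ) (u : ℝ → ℝ → ℝ), BackwardFramework u Tbar →
        ∀ p ∈ Dom Tbar, |u p.1 p.2| ≤ C (locE u Tbar) := by
  refine ⟨fun x => Real.sqrt (2 * x + 1), fun _ _ => Real.sqrt_nonneg _, ?_⟩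
  rintro T u h ⟨t, r⟩ ⟨ht0, ht1, hr0, hr1⟩
  simp only at ht0 ht1 hr0 hr1 ⊢
  obtain ⟨hr2, hr3⟩ := le_min_iff.1 hr1
  rcases hr0.eq_or_lt with rfl | hr0
  · rw [h.eq_zero_on_axis ht0 ht1, abs_zero]
    exact Real.sqrt_nonneg _
  refine Real.abs_le_sqrt ?_
  rcases le_total t T with htT | htT
  · refine h.sq_le_of_characteristic (σ := 1) (S := T - t) (by norm_num) (by linarith) (by ring)
      hr0 (by linarith) fun s hs x hx => ?_
    obtain ⟨hs0, hs1⟩ := hs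
    obtain ⟨hx0, hx1⟩ := hx
    refine ⟨?_, ?_, hx0, le_min ?_ ?_⟩ <;> simp only <;> linarith
  · refine h.sq_le_of_characteristic (σ := -1) (S := t - T) (by norm_num) (by linarith) (by ring)
      hr0 (by linarith) fun s hs x hx => ?_
    obtain ⟨hs0, hs1⟩ := hs
    obtain ⟨hx0, hx1⟩ := hx
    have := h.1
    refine ⟨?_, ?_, hx0, le_min ?_ ?_⟩ <;> simp only <;> linarith
end

section
/- In the backward framework, for every 0 < T ≤ T̄ the local energy on the time slice equals the corresponding backward-light-cone integral: ∫_0^T [(1/2)(u_t(T,r)² + u_r(T,r)²) + sin²u(T,r)/r² + (u(T,r) − sin u(T,r)·cos u(T,r))²/(2r⁴)] r² dr = ∫_0^T [(1/2)u₋(2T−r, r)² + sin²u(2T−r, r)/r² + (u(2T−r,r) − sin u(2T−r,r)·cos u(2T−r,r))²/(2r⁴)] r² dr. -/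
open Real MeasureTheory Set Filter Topology

/-- If two nonnegative functions have truncated integrals differing by `o(1)` and the first one is
integrable on `(0, T]`, then so is the second one, with the same integral. -/
lemma integrableOn_and_integral_eq_of_tendsto_sub {F G : ℝ → ℝ} {T : ℝ} (hT : 0 < T)
    (hG : ContinuousOn G (Ioc 0 T)) (hF0 : ∀ r, 0 ≤ F r) (hG0 : ∀ r, 0 ≤ G r)
    (hlim : Tendsto (fun ε => (∫ r in ε..T, G r) - ∫ r in ε..T, F r) (𝓝[>] 0) (𝓝 0))
    (hF : IntegrableOn F (Ioc 0 T)) :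
    IntegrableOn G (Ioc 0 T) ∧ ∫ r in (0 : ℝ)..T, F r = ∫ r in (0 : ℝ)..T, G r := by
  have hev : ∀ᶠ ε in 𝓝[>] (0 : ℝ), ε ∈ Ioo 0 T := Ioo_mem_nhdsGT hT
  have hGint : IntegrableOn G (Ioc 0 T) := by
    have hle : Tendsto (fun ε : ℝ => max ε 0) (𝓝[>] 0) (𝓝 0) := by
      have : Continuous fun ε : ℝ => max ε 0 := by fun_prop
      simpa using (this.tendsto 0).mono_left nhdsWithin_le_nhds
    have hu : Tendsto (fun n : ℕ => T / ((n : ℝ) + 2)) atTop (𝓝[>] 0) := by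
      refine tendsto_nhdsWithin_iff.2 ⟨?_, Eventually.of_forall fun n => ?_⟩
      · exact Tendsto.const_div_atTop
          (tendsto_atTop_add_const_right _ _ tendsto_natCast_atTop_atTop) _
      · show (0 : ℝ) < T / ((n : ℝ) + 2)
        positivity
    refine integrableOn_Ioc_of_intervalIntegral_norm_bounded_left (l := atTop)
      (a := fun n : ℕ => T / ((n : ℝ) + 2)) (I := (∫ r in Ioc 0 T, F r) + 1) (fun n => ?_)
      (hu.mono_right nhdsWithin_le_nhds) ?_
    · have hpos : 0 < T / ((n : ℝ) + 2) := by positivity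
      exact ((hG.mono fun x hx => ⟨hpos.trans_le hx.1, hx.2⟩).integrableOn_Icc).mono_set
        Ioc_subset_Icc_self
    · have h1 := hu.eventually ((hlim.eventually (gt_mem_nhds one_pos)).and hev)
      filter_upwards [h1] with n hn
      obtain ⟨hn1, hn2⟩ := hn
      rw [intervalIntegral.integral_of_le hn2.2.le, intervalIntegral.integral_of_le hn2.2.le]
        at hn1
      have h2 : ∫ r in Ioc (T / ((n : ℝ) + 2)) T, F r ≤ ∫ r in Ioc 0 T, F r :=
        setIntegral_mono_set hF (ae_of_all _ hF0)
          (Ioc_subset_Ioc_left hn2.1.le).eventuallyLE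
      simp only [Real.norm_eq_abs, abs_of_nonneg (hG0 _)]
      linarith
  refine ⟨hGint, ?_⟩
  have htr : ∀ {H : ℝ → ℝ}, IntegrableOn H (Ioc 0 T) →
      Tendsto (fun ε => ∫ r in ε..T, H r) (𝓝[>] 0) (𝓝 (∫ r in (0 : ℝ)..T, H r)) := by
    intro H hH
    have hc := intervalIntegral.continuousOn_primitive_interval_left (f := H) (μ := volume)
      (a := 0) (b := T) (by rwa [uIcc_of_le hT.le, integrableOn_Icc_iff_integrableOn_Ioc])
    rw [uIcc_of_le hT.le] at hc
    exact (hc 0 (left_mem_Icc.2 hT.le)).mono_left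
      (nhdsWithin_le_of_mem (mem_of_superset (Ioo_mem_nhdsGT hT) Ioo_subset_Icc_self))
  have := tendsto_nhds_unique hlim ((htr hGint).sub (htr hF))
  linarith

/-- Two functions that are nonnegative, and continuous on `(0, T]`, and whose truncated integrals
differ by `o(1)` have the same integral over `(0, T]`, with value `0` if they are not integrable. -/
lemma integral_eq_of_tendsto_sub {F G : ℝ → ℝ} {T : ℝ} (hT : 0 < T)
    (hF : ContinuousOn F (Ioc 0 T)) (hG : ContinuousOn G (Ioc 0 T))
    (hF0 : ∀ r, 0 ≤ F r) (hG0 : ∀ r, 0 ≤ G r)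
    (hlim : Tendsto (fun ε => (∫ r in ε..T, G r) - ∫ r in ε..T, F r) (𝓝[>] 0) (𝓝 0)) :
    ∫ r in (0 : ℝ)..T, F r = ∫ r in (0 : ℝ)..T, G r := by
  by_cases hFi : IntegrableOn F (Ioc 0 T)
  · exact (integrableOn_and_integral_eq_of_tendsto_sub hT hG hF0 hG0 hlim hFi).2
  by_cases hGi : IntegrableOn G (Ioc 0 T)
  · refine (integrableOn_and_integral_eq_of_tendsto_sub hT hF hG0 hF0 ?_ hGi).2.symm
    simpa using hlim.neg
  rw [intervalIntegral.integral_of_le hT.le, intervalIntegral.integral_of_le hT.le,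
    integral_undef hFi, integral_undef hGi]

/-- Integrating the closed one-form `A dr + B dt` over the boundary of the triangle
`{ε ≤ r, T ≤ t ≤ 2T - r}`, swept out by the segments `t = T + s (T - r)`, `0 ≤ s ≤ 1`. -/
lemma integral_cone_sub_integral_slice {A B : ℝ × ℝ → ℝ} {T ε : ℝ} (hε : ε ≤ T)
    (hA : ∀ t r, T ≤ t → ε ≤ r → t + r ≤ 2 * T → DifferentiableAt ℝ A (t, r))
    (hB : ∀ t r, T ≤ t → ε ≤ r → t + r ≤ 2 * T → DifferentiableAt ℝ B (t, r))
    (hAB : ∀ t r, T ≤ t → ε ≤ r → t + r ≤ 2 * T →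
      fderiv ℝ A (t, r) (1, 0) = fderiv ℝ B (t, r) (0, 1)) :
    (∫ r in ε..T, (A (2 * T - r, r) - B (2 * T - r, r))) - ∫ r in ε..T, A (T, r) =
      -∫ s in (0 : ℝ)..1, (T - ε) * B (T + s * (T - ε), ε) := by
  set φ : ℝ × ℝ → ℝ × ℝ := fun x => (T + x.1 * (T - x.2), x.2) with hφ
  set φ' : ℝ × ℝ → ℝ × ℝ →L[ℝ] ℝ × ℝ := fun x =>
    (x.1 • (-ContinuousLinearMap.snd ℝ ℝ ℝ) +
      (T - x.2) • ContinuousLinearMap.fst ℝ ℝ ℝ).prod (ContinuousLinearMap.snd ℝ ℝ ℝ) with hφ'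
  have hφd : ∀ x, HasFDerivAt φ (φ' x) x := fun x =>
    ((hasFDerivAt_fst.mul (hasFDerivAt_snd.const_sub T)).const_add T).prodMk hasFDerivAt_snd
  have hmem : ∀ x ∈ Icc (0 : ℝ) 1 ×ˢ Icc ε T,
      T ≤ T + x.1 * (T - x.2) ∧ ε ≤ x.2 ∧ T + x.1 * (T - x.2) + x.2 ≤ 2 * T := by
    rintro ⟨s, r⟩ ⟨⟨h0, h1⟩, h2, h3⟩
    dsimp only at *
    refine ⟨?_, h2, ?_⟩ <;> nlinarith
  have hAφ : ∀ x ∈ Icc (0 : ℝ) 1 ×ˢ Icc ε T,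
      HasFDerivAt (fun x => A (φ x)) ((fderiv ℝ A (φ x)).comp (φ' x)) x := fun x hx =>
    HasFDerivAt.comp x
      (hA _ _ (hmem x hx).1 (hmem x hx).2.1 (hmem x hx).2.2).hasFDerivAt (hφd x)
  have hBφ : ∀ x ∈ Icc (0 : ℝ) 1 ×ˢ Icc ε T,
      HasFDerivAt (fun x => B (φ x)) ((fderiv ℝ B (φ x)).comp (φ' x)) x := fun x hx =>
    HasFDerivAt.comp x
      (hB _ _ (hmem x hx).1 (hmem x hx).2.1 (hmem x hx).2.2).hasFDerivAt (hφd x)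
  have hf : ∀ x ∈ Icc (0 : ℝ) 1 ×ˢ Icc ε T,
      HasFDerivAt (fun x => A (φ x) - x.1 * B (φ x)) ((fderiv ℝ A (φ x)).comp (φ' x) -
        (x.1 • (fderiv ℝ B (φ x)).comp (φ' x) + B (φ x) • ContinuousLinearMap.fst ℝ ℝ ℝ)) x :=
    fun x hx => (hAφ x hx).sub (hasFDerivAt_fst.mul (hBφ x hx))
  have hg : ∀ x ∈ Icc (0 : ℝ) 1 ×ˢ Icc ε T,
      HasFDerivAt (fun x => -((T - x.2) * B (φ x))) (-((T - x.2) • (fderiv ℝ B (φ x)).comp (φ' x) +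
        B (φ x) • (-ContinuousLinearMap.snd ℝ ℝ ℝ))) x :=
    fun x hx => ((hasFDerivAt_snd.const_sub T).mul (hBφ x hx)).neg
  have hdiv : ∀ x ∈ Icc (0 : ℝ) 1 ×ˢ Icc ε T, ((fderiv ℝ A (φ x)).comp (φ' x) -
        (x.1 • (fderiv ℝ B (φ x)).comp (φ' x) + B (φ x) • ContinuousLinearMap.fst ℝ ℝ ℝ)) (1, 0) +
      (-((T - x.2) • (fderiv ℝ B (φ x)).comp (φ' x) +
        B (φ x) • (-ContinuousLinearMap.snd ℝ ℝ ℝ))) (0, 1) = 0 := by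
    intro x hx
    have h1 := hAB _ _ (hmem x hx).1 (hmem x hx).2.1 (hmem x hx).2.2
    have e1 : φ' x (1, 0) = (T - x.2) • ((1, 0) : ℝ × ℝ) := by simp [hφ']
    have e2 : φ' x (0, 1) = (-x.1) • ((1, 0) : ℝ × ℝ) + ((0, 1) : ℝ × ℝ) := by simp [hφ']
    simp only [sub_apply, add_apply,
      smul_apply, ContinuousLinearMap.comp_apply,
      neg_apply, ContinuousLinearMap.coe_fst', ContinuousLinearMap.coe_snd',
      e1, e2, map_smul, map_add, smul_eq_mul]
    change fderiv ℝ A (φ x) (1, 0) = fderiv ℝ B (φ x) (0, 1) at h1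
    rw [h1]
    ring
  have huIcc : uIcc (0 : ℝ) 1 ×ˢ uIcc ε T = Icc (0 : ℝ) 1 ×ˢ Icc ε T := by
    rw [uIcc_of_le zero_le_one, uIcc_of_le hε]
  have hIoo : Ioo (min (0 : ℝ) 1) (max 0 1) ×ˢ Ioo (min ε T) (max ε T) ⊆
      Icc (0 : ℝ) 1 ×ˢ Icc ε T := by
    rw [min_eq_left zero_le_one, max_eq_right zero_le_one, min_eq_left hε, max_eq_right hε]
    exact prod_mono Ioo_subset_Icc_self Ioo_subset_Icc_self
  have key := integral2_divergence_prod_of_hasFDerivAt _ _ _ _ 0 ε 1 T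
    (by rw [huIcc]; exact fun x hx => (hf x hx).continuousAt.continuousWithinAt)
    (by rw [huIcc]; exact fun x hx => (hg x hx).continuousAt.continuousWithinAt)
    (fun x hx => hf x (hIoo hx)) (fun x hx => hg x (hIoo hx))
    (by
      rw [huIcc]
      exact integrableOn_zero.congr_fun (fun x hx => (hdiv x hx).symm)
        (measurableSet_Icc.prod measurableSet_Icc))
  have hzero : (∫ s in (0 : ℝ)..1, ∫ r in ε..T, (((fderiv ℝ A (φ (s, r))).comp (φ' (s, r)) -
        ((s, r).1 • (fderiv ℝ B (φ (s, r))).comp (φ' (s, r)) +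
          B (φ (s, r)) • ContinuousLinearMap.fst ℝ ℝ ℝ)) (1, 0) +
      (-((T - (s, r).2) • (fderiv ℝ B (φ (s, r))).comp (φ' (s, r)) +
        B (φ (s, r)) • (-ContinuousLinearMap.snd ℝ ℝ ℝ))) (0, 1))) = 0 := by
    rw [intervalIntegral.integral_congr (g := fun _ => (0 : ℝ))]
    · simp
    · intro s hs
      dsimp only
      rw [intervalIntegral.integral_congr (g := fun _ => (0 : ℝ))]
      · simp
      · intro r hr
        rw [uIcc_of_le zero_le_one] at hs
        rw [uIcc_of_le hε] at hr
        exact hdiv (s, r) ⟨hs, hr⟩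
  rw [hzero] at key
  have e3 : ∀ r : ℝ, T + (T - r) = 2 * T - r := fun r => by ring
  simp only [hφ, sub_self, zero_mul, neg_zero, intervalIntegral.integral_zero, one_mul, add_zero,
    sub_zero, intervalIntegral.integral_neg, e3] at key
  linarith

section Regularity

variable {u : ℝ → ℝ → ℝ} {V : Set (ℝ × ℝ)}

lemma hasDerivAt_fst_slice {f : ℝ × ℝ → ℝ} {p : ℝ × ℝ} (hf : DifferentiableAt ℝ f p) :
    HasDerivAt (fun s => f (s, p.2)) (fderiv ℝ f p (1, 0)) p.1 :=
  HasFDerivAt.comp_hasDerivAt (f := fun s : ℝ => (s, p.2)) p.1 hf.hasFDerivAt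
    ((hasDerivAt_id p.1).prodMk (hasDerivAt_const p.1 p.2))

lemma hasDerivAt_snd_slice {f : ℝ × ℝ → ℝ} {p : ℝ × ℝ} (hf : DifferentiableAt ℝ f p) :
    HasDerivAt (fun s => f (p.1, s)) (fderiv ℝ f p (0, 1)) p.2 :=
  HasFDerivAt.comp_hasDerivAt (f := fun s : ℝ => (p.1, s)) p.2 hf.hasFDerivAt
    ((hasDerivAt_const p.2 p.1).prodMk (hasDerivAt_id p.2))

lemma ut_eq_fderiv {p : ℝ × ℝ} (h : DifferentiableAt ℝ (fun p : ℝ × ℝ => u p.1 p.2) p) :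
    ut u p.1 p.2 = fderiv ℝ (fun p : ℝ × ℝ => u p.1 p.2) p (1, 0) :=
  (hasDerivAt_fst_slice h).deriv

lemma ur_eq_fderiv {p : ℝ × ℝ} (h : DifferentiableAt ℝ (fun p : ℝ × ℝ => u p.1 p.2) p) :
    ur u p.1 p.2 = fderiv ℝ (fun p : ℝ × ℝ => u p.1 p.2) p (0, 1) :=
  (hasDerivAt_snd_slice h).deriv

lemma differentiableAt_of_mem (hV : IsOpen V)
    (hu : ContDiffOn ℝ (⊤ : ℕ∞) (fun p : ℝ × ℝ => u p.1 p.2) V) {p : ℝ × ℝ} (hp : p ∈ V) :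
    DifferentiableAt ℝ (fun p : ℝ × ℝ => u p.1 p.2) p :=
  (hu.contDiffAt (hV.mem_nhds hp)).differentiableAt (by simp)

lemma differentiableAt_fderiv_of_mem (hV : IsOpen V)
    (hu : ContDiffOn ℝ (⊤ : ℕ∞) (fun p : ℝ × ℝ => u p.1 p.2) V) {p : ℝ × ℝ} (hp : p ∈ V) :
    DifferentiableAt ℝ (fderiv ℝ (fun p : ℝ × ℝ => u p.1 p.2)) p :=
  ((hu.contDiffAt (hV.mem_nhds hp)).fderiv_right (m := 1)
    (by norm_cast)).differentiableAt (by simp)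

lemma hasFDerivAt_ut (hV : IsOpen V)
    (hu : ContDiffOn ℝ (⊤ : ℕ∞) (fun p : ℝ × ℝ => u p.1 p.2) V) {p : ℝ × ℝ} (hp : p ∈ V) :
    HasFDerivAt (fun p : ℝ × ℝ => ut u p.1 p.2)
      ((fderiv ℝ (fderiv ℝ (fun p : ℝ × ℝ => u p.1 p.2)) p).flip (1, 0)) p := by
  refine HasFDerivAt.congr_of_eventuallyEq (f := fun q =>
    fderiv ℝ (fun p : ℝ × ℝ => u p.1 p.2) q (1, 0)) ?_ ?_
  · simpa using (differentiableAt_fderiv_of_mem hV hu hp).hasFDerivAt.clm_apply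
      (hasFDerivAt_const ((1, 0) : ℝ × ℝ) p)
  · filter_upwards [hV.mem_nhds hp] with q hq
    exact ut_eq_fderiv (differentiableAt_of_mem hV hu hq)

lemma hasFDerivAt_ur (hV : IsOpen V)
    (hu : ContDiffOn ℝ (⊤ : ℕ∞) (fun p : ℝ × ℝ => u p.1 p.2) V) {p : ℝ × ℝ} (hp : p ∈ V) :
    HasFDerivAt (fun p : ℝ × ℝ => ur u p.1 p.2)
      ((fderiv ℝ (fderiv ℝ (fun p : ℝ × ℝ => u p.1 p.2)) p).flip (0, 1)) p := by
  refine HasFDerivAt.congr_of_eventuallyEq (f := fun q =>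
    fderiv ℝ (fun p : ℝ × ℝ => u p.1 p.2) q (0, 1)) ?_ ?_
  · simpa using (differentiableAt_fderiv_of_mem hV hu hp).hasFDerivAt.clm_apply
      (hasFDerivAt_const ((0, 1) : ℝ × ℝ) p)
  · filter_upwards [hV.mem_nhds hp] with q hq
    exact ur_eq_fderiv (differentiableAt_of_mem hV hu hq)

lemma fderiv_ut_snd_eq_fderiv_ur_fst (hV : IsOpen V)
    (hu : ContDiffOn ℝ (⊤ : ℕ∞) (fun p : ℝ × ℝ => u p.1 p.2) V) {p : ℝ × ℝ} (hp : p ∈ V) :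
    fderiv ℝ (fun p : ℝ × ℝ => ut u p.1 p.2) p (0, 1) =
      fderiv ℝ (fun p : ℝ × ℝ => ur u p.1 p.2) p (1, 0) := by
  rw [(hasFDerivAt_ut hV hu hp).fderiv, (hasFDerivAt_ur hV hu hp).fderiv]
  exact (hu.contDiffAt (hV.mem_nhds hp)).isSymmSndFDerivAt (by simp; norm_cast) _ _

lemma differentiableAt_energy (hV : IsOpen V)
    (hu : ContDiffOn ℝ (⊤ : ℕ∞) (fun p : ℝ × ℝ => u p.1 p.2) V) {p : ℝ × ℝ} (hp : p ∈ V) (hr : p.2 ≠ 0) :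
    DifferentiableAt ℝ (fun p : ℝ × ℝ => eDens u p.1 p.2 * p.2 ^ 2) p := by
  have h0 := differentiableAt_of_mem hV hu hp
  have h1 := (hasFDerivAt_ut hV hu hp).differentiableAt
  have h2 := (hasFDerivAt_ur hV hu hp).differentiableAt
  have h3 : p.2 ^ 2 ≠ 0 := pow_ne_zero _ hr
  have h4 : 2 * p.2 ^ 4 ≠ 0 := mul_ne_zero two_ne_zero (pow_ne_zero _ hr)
  unfold eDens
  fun_prop (disch := assumption)

lemma differentiableAt_momentum (hV : IsOpen V)
    (hu : ContDiffOn ℝ (⊤ : ℕ∞) (fun p : ℝ × ℝ => u p.1 p.2) V) {p : ℝ × ℝ} (hp : p ∈ V) :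
    DifferentiableAt ℝ (fun p : ℝ × ℝ => p.2 ^ 2 * (ut u p.1 p.2 * ur u p.1 p.2)) p := by
  have h1 := (hasFDerivAt_ut hV hu hp).differentiableAt
  have h2 := (hasFDerivAt_ur hV hu hp).differentiableAt
  fun_prop

/-- The energy identity `∂ₜ (r² e) = ∂ᵣ (r² uₜ uᵣ)`. -/
lemma fderiv_energy_eq_fderiv_momentum (hV : IsOpen V)
    (hu : ContDiffOn ℝ (⊤ : ℕ∞) (fun p : ℝ × ℝ => u p.1 p.2) V) {p : ℝ × ℝ} (hp : p ∈ V) (hr : p.2 ≠ 0)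
    (heq : ANeq u p.1 p.2) :
    fderiv ℝ (fun p : ℝ × ℝ => eDens u p.1 p.2 * p.2 ^ 2) p (1, 0) =
      fderiv ℝ (fun p : ℝ × ℝ => p.2 ^ 2 * (ut u p.1 p.2 * ur u p.1 p.2)) p (0, 1) := by
  have d0 := differentiableAt_of_mem hV hu hp
  have d1 := (hasFDerivAt_ut hV hu hp).differentiableAt
  have d2 := (hasFDerivAt_ur hV hu hp).differentiableAt
  have hA := hasDerivAt_fst_slice (differentiableAt_energy hV hu hp hr)
  have hB := hasDerivAt_snd_slice (differentiableAt_momentum hV hu hp)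
  have u_t : HasDerivAt (fun s => u s p.2) (ut u p.1 p.2) p.1 := by
    rw [ut_eq_fderiv d0]; exact hasDerivAt_fst_slice d0
  have u_tt := hasDerivAt_fst_slice d1
  have u_rt := hasDerivAt_fst_slice d2
  have u_tr := hasDerivAt_snd_slice d1
  have u_rr := hasDerivAt_snd_slice d2
  rw [← fderiv_ut_snd_eq_fderiv_ur_fst hV hu hp] at u_rt
  have ett : utt u p.1 p.2 = _ := u_tt.deriv
  have err : urr u p.1 p.2 = _ := u_rr.deriv
  rw [← ett] at u_tt
  rw [← err] at u_rr
  have hA' := ((((u_tt.pow 2).add (u_rt.pow 2)).const_mul (1 / 2)).add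
    ((u_t.sin.pow 2).div_const (p.2 ^ 2)) |>.add
    (((u_t.sub (u_t.sin.mul u_t.cos)).pow 2).div_const (2 * p.2 ^ 4))).mul_const (p.2 ^ 2)
  have hB' := ((hasDerivAt_id p.2).pow 2).mul (u_tr.mul u_rr)
  rw [hA.unique hA', hB.unique hB']
  unfold ANeq at heq
  have e : utt u p.1 p.2 = urr u p.1 p.2 + (2 / p.2) * ur u p.1 p.2
      - Real.sin (2 * u p.1 p.2) / p.2 ^ 2
      - (u p.1 p.2 - Real.sin (u p.1 p.2) * Real.cos (u p.1 p.2)) *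
        (1 - Real.cos (2 * u p.1 p.2)) / p.2 ^ 4 := by linarith
  rw [e, Real.sin_two_mul, Real.cos_two_mul]
  have hsc := Real.sin_sq_add_cos_sq (u p.1 p.2)
  have hs2 : Real.sin (u p.1 p.2) ^ 2 = 1 - Real.cos (u p.1 p.2) ^ 2 := by linarith
  simp
  field_simp
  ring_nf
  simp only [hs2]
  linear_combination
    (-(ut u p.1 p.2 * Real.sin (u p.1 p.2) * Real.cos (u p.1 p.2))) * hsc

end Regularity

/-- Equivalence of the two expressions for the local energy: for `0 < T ≤ T̄`, the energy
on the time slice `{T} × [0,T]` equals the corresponding integral over the backward light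
cone `K_T = {t = 2T - r}`. -/
theorem locE_eq_cone_integral (u : ℝ → ℝ → ℝ) (Tbar : ℝ)
    (h : BackwardFramework u Tbar) :
    ∀ T : ℝ, 0 < T → T ≤ Tbar →
      (∫ r in (0 : ℝ)..T, eDens u T r * r ^ 2) =
        ∫ r in (0 : ℝ)..T,
          ((1 / 2) * uminus u (2 * T - r) r ^ 2 +
            Real.sin (u (2 * T - r) r) ^ 2 / r ^ 2 +
            (u (2 * T - r) r -
              Real.sin (u (2 * T - r) r) * Real.cos (u (2 * T - r) r)) ^ 2 /
              (2 * r ^ 4)) * r ^ 2 := by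
  intro T hT hTT
  obtain ⟨-, ⟨V, hV, hDV, hu⟩, heq, -⟩ := h
  set A : ℝ × ℝ → ℝ := fun p => eDens u p.1 p.2 * p.2 ^ 2 with hAdef
  set B : ℝ × ℝ → ℝ := fun p => p.2 ^ 2 * (ut u p.1 p.2 * ur u p.1 p.2) with hBdef
  have hdom : ∀ t r, T ≤ t → 0 ≤ r → t + r ≤ 2 * T → (t, r) ∈ Dom Tbar := fun t r h1 h2 h3 =>
    ⟨by dsimp only; linarith, by dsimp only; linarith, h2, le_min (by dsimp only; linarith)
      (by dsimp only; linarith)⟩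
  have hA : ∀ t r, T ≤ t → 0 < r → t + r ≤ 2 * T → DifferentiableAt ℝ A (t, r) :=
    fun t r h1 h2 h3 => differentiableAt_energy hV hu (hDV (hdom t r h1 h2.le h3)) h2.ne'
  have hB : ∀ t r, T ≤ t → 0 ≤ r → t + r ≤ 2 * T → DifferentiableAt ℝ B (t, r) :=
    fun t r h1 h2 h3 => differentiableAt_momentum hV hu (hDV (hdom t r h1 h2 h3))
  have hcone : ∀ r, ((1 / 2) * uminus u (2 * T - r) r ^ 2 +
      Real.sin (u (2 * T - r) r) ^ 2 / r ^ 2 +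
      (u (2 * T - r) r - Real.sin (u (2 * T - r) r) * Real.cos (u (2 * T - r) r)) ^ 2 /
        (2 * r ^ 4)) * r ^ 2 = A (2 * T - r, r) - B (2 * T - r, r) := by
    intro r
    simp only [hAdef, hBdef, uminus, eDens]
    ring
  refine integral_eq_of_tendsto_sub hT ?_ ?_ (fun r => by unfold eDens; positivity)
    (fun r => by positivity) ?_
  · intro r hr
    have := (hA T r le_rfl hr.1 (by linarith [hr.2])).continuousAt
    exact (ContinuousAt.comp (f := fun s : ℝ => (T, s)) this
      (by fun_prop)).continuousWithinAt
  · simp only [hcone]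
    intro r hr
    have h1 := (hA (2 * T - r) r (by linarith [hr.2]) hr.1 (by linarith)).continuousAt
    have h2 := (hB (2 * T - r) r (by linarith [hr.2]) hr.1.le (by linarith)).continuousAt
    exact (ContinuousAt.comp (g := fun p => A p - B p) (f := fun s : ℝ => (2 * T - s, s))
      (h1.sub h2) (by fun_prop)).continuousWithinAt
  simp only [hcone]
  have hflux : ∀ᶠ ε in 𝓝[>] (0 : ℝ), ε ∈ Ioo 0 T := Ioo_mem_nhdsGT hT
  obtain ⟨C, hC⟩ : ∃ C, ∀ t r, T ≤ t → 0 ≤ r → t + r ≤ 2 * T →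
      |ut u t r * ur u t r| ≤ C := by
    have hK : IsCompact ({p : ℝ × ℝ | T ≤ p.1 ∧ 0 ≤ p.2 ∧ p.1 + p.2 ≤ 2 * T}) := by
      refine (isCompact_Icc (a := ((T, 0) : ℝ × ℝ)) (b := (2 * T, T))).of_isClosed_subset ?_ ?_
      · exact (isClosed_le continuous_const continuous_fst).inter
          ((isClosed_le continuous_const continuous_snd).inter
            (isClosed_le (continuous_fst.add continuous_snd) continuous_const))
      · rintro ⟨t, r⟩ ⟨h1, h2, h3⟩
        dsimp only at h1 h2 h3
        exact ⟨⟨h1, h2⟩, by dsimp only; linarith, by dsimp only; linarith⟩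
    obtain ⟨C, hC⟩ := hK.exists_bound_of_continuousOn
      (f := fun p : ℝ × ℝ => ut u p.1 p.2 * ur u p.1 p.2) (fun p hp => by
        have hpV := hDV (hdom p.1 p.2 hp.1 hp.2.1 hp.2.2)
        exact ((hasFDerivAt_ut hV hu hpV).continuousAt.mul
          (hasFDerivAt_ur hV hu hpV).continuousAt).continuousWithinAt)
    exact ⟨C, fun t r h1 h2 h3 => hC (t, r) ⟨h1, h2, h3⟩⟩
  refine squeeze_zero_norm' (a := fun ε => (T - ε) * (ε ^ 2 * C)) ?_ ?_
  · filter_upwards [hflux] with ε hε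
    have key := integral_cone_sub_integral_slice (A := A) (B := B) hε.2.le
      (fun t r h1 h2 h3 => hA t r h1 (hε.1.trans_le h2) h3)
      (fun t r h1 h2 h3 => hB t r h1 (hε.1.le.trans h2) h3)
      (fun t r h1 h2 h3 => fderiv_energy_eq_fderiv_momentum hV hu
        (hDV (hdom t r h1 (hε.1.le.trans h2) h3)) (hε.1.trans_le h2).ne'
        (heq _ (hdom t r h1 (hε.1.le.trans h2) h3) (hε.1.trans_le h2)))
    change ‖(∫ r in ε..T, (A (2 * T - r, r) - B (2 * T - r, r))) - ∫ r in ε..T, A (T, r)‖ ≤ _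
    rw [key, norm_neg]
    refine (intervalIntegral.norm_integral_le_of_norm_le_const
      (C := (T - ε) * (ε ^ 2 * C)) fun s hs => ?_).trans (by simp)
    rw [uIoc_of_le zero_le_one] at hs
    have hTε : 0 ≤ T - ε := by linarith [hε.2]
    simp only [hBdef, norm_mul, Real.norm_eq_abs, abs_of_nonneg hTε, abs_of_nonneg (sq_nonneg ε)]
    rw [← abs_mul]
    gcongr
    exact hC _ _ (by nlinarith [hs.1]) hε.1.le (by nlinarith [hs.2])
  · have : Continuous fun ε : ℝ => (T - ε) * (ε ^ 2 * C) := by fun_prop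
    simpa using (this.tendsto 0).mono_left (nhdsWithin_le_nhds (s := Ioi 0))
end
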